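/- Fix integers n ≥ 2 and 1 ≤ q ≤ n, and a real constant 0 < c < 1/2. For all ε > 0 and η > 0 there exists an integer R such that for every integer r ≥ R and every integer p with 0 ≤ p ≤ r−n and c·r ≤ p ≤ (1−c)·r, the product probability measure of the set { x ∈ Ω_r : | k_{p,q}(x) / ( C(r−n,p) · μ_{q,n}(r,p) ) − 1 | > ε } is less than η. -/

import Mathlib

open MeasureTheory Filter

noncomputable section

/-- `σ_b(a)`: sum over all `b`-element subsets `J` of `{1,…,a}` of the product of elements. -/
def sigmaFn (b a : ℕ) : ℕ := ∑ J ∈ (Finset.Icc 1 a).powersetCard b, ∏ j ∈ J, j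

/-- the `(α+1)`-st smallest element of a finite set of naturals (0-indexed). -/
def nthElt (I : Finset ℕ) (α : ℕ) : ℕ := (I.sort (· ≤ ·)).getD α 0

/-- the product `∏_{α=1}^{q−1} (p+q−i_α)_+ · ∏_{α=q}^{n−1} (i_α−p−q)_+`. -/
def pureNum (n p q : ℕ) (I : Finset ℕ) : ℤ :=
  ∏ α ∈ Finset.range (n - 1),
    if α + 1 < q then max ((p : ℤ) + q - nthElt I α) 0
    else max ((nthElt I α : ℤ) - p - q) 0

/-- the entry `k_{p,q}(π(r,I))` of the pure diagram `π(r,I)`. -/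
def kPure (n r p q : ℕ) (I : Finset ℕ) : ℝ :=
  ((r - n).factorial : ℝ) * (pureNum n p q I : ℝ) /
    (((p + q - 1).factorial : ℝ) * ((r - p - q).factorial : ℝ))

/-- `μ_{q,n}(r,p)`. -/
def muFn (n q r p : ℕ) : ℝ :=
  (1 / 2 ^ n) * ((p : ℝ) ^ (q - 1) * ((r : ℝ) - p - n) ^ (n - q)) /
    ((q - 1).factorial * (n - q).factorial)

/-- the cube `Ω_r = [0,1]^{\binom{[r]}{n-1}}` with its product (Lebesgue) probability
measure, realized as the product over the `(n-1)`-element subsets of `{1,…,r}` of the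
uniform measure on `[0,1] ⊆ ℝ`. -/
def cubeMeasure (n r : ℕ) : Measure ((↥((Finset.Icc 1 r).powersetCard (n - 1))) → ℝ) :=
  Measure.pi fun _ => volume.restrict (Set.Icc 0 1)

/-- `k_{p,q}(x) = ∑_I x_I · k_{p,q}(π(r,I))` for a coefficient vector `x ∈ Ω_r`. -/
def kRand (n r p q : ℕ) (x : (↥((Finset.Icc 1 r).powersetCard (n - 1))) → ℝ) : ℝ :=
  ∑ I : ↥((Finset.Icc 1 r).powersetCard (n - 1)), x I * kPure n r p q (I : Finset ℕ)

lemma aux_prob' {ι : Type*} [Fintype ι] (w : ι → ℝ) (δ : ℝ) (hδ : 0 < δ)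
    (ν : Measure ℝ) [IsProbabilityMeasure ν]
    (hae : ∀ᵐ y ∂ν, y ∈ Set.Icc (0 : ℝ) 1) (hm : ∫ y, y ∂ν = 1 / 2) :
    (Measure.pi fun _ : ι => ν)
      {x | δ ≤ |∑ i, x i * w i - (∑ i, w i) / 2|} ≤ ENNReal.ofReal ((∑ i, w i ^ 2) / δ ^ 2) := by
  have hid : MemLp (fun y : ℝ => y) 2 ν := by
    refine MemLp.of_bound (C := 1) (by fun_prop) ?_
    filter_upwards [hae] with y hy
    rw [Real.norm_eq_abs, abs_le]
    constructor <;> linarith [hy.1, hy.2]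
  have hX : ∀ i : ι, MemLp (fun y : ℝ => y * w i) 2 ν := fun i => hid.mul_const (w i)
  have hXp : ∀ i : ι, MemLp (fun x : ι → ℝ => x i * w i) 2 (Measure.pi fun _ : ι => ν) := fun i =>
    (hX i).comp_measurePreserving (measurePreserving_eval (fun _ : ι => ν) i)
  have hvar : ProbabilityTheory.variance (∑ i, fun x : ι → ℝ => x i * w i)
      (Measure.pi fun _ : ι => ν) = ∑ i, ProbabilityTheory.variance (fun y : ℝ => y * w i) ν :=
    ProbabilityTheory.variance_sum_pi (Ω := fun _ : ι => ℝ) (μ := fun _ : ι => ν)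
      (X := fun i (y : ℝ) => y * w i) hX
  have hv1 : ∀ i, ProbabilityTheory.variance (fun y : ℝ => y * w i) ν ≤ w i ^ 2 := by
    intro i
    have h1 := ProbabilityTheory.variance_le_sq_of_bounded (X := fun y : ℝ => y) hae (by fun_prop)
    have h2 : ProbabilityTheory.variance (fun y : ℝ => y * w i) ν
        = w i ^ 2 * ProbabilityTheory.variance (fun y : ℝ => y) ν := by
      rw [← ProbabilityTheory.variance_const_mul]
      simp_rw [mul_comm]
    rw [h2]
    nlinarith [sq_nonneg (w i)]
  have hmean : ∫ x, (∑ i, fun x : ι → ℝ => x i * w i) x ∂(Measure.pi fun _ : ι => ν)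
      = (∑ i, w i) / 2 := by
    simp only [Finset.sum_apply]
    rw [integral_finsetSum _ (fun i _ => (hXp i).integrable (by norm_num)), Finset.sum_div]
    refine Finset.sum_congr rfl fun i _ => ?_
    rw [integral_comp_eval (μ := fun _ : ι => ν) (f := fun y => y * w i) (by fun_prop),
      integral_mul_const]
    rw [hm]; ring
  have hch := ProbabilityTheory.meas_ge_le_variance_div_sq
    (X := ∑ i, fun x : ι → ℝ => x i * w i) (μ := Measure.pi fun _ : ι => ν)
    (memLp_finsetSum' _ fun i _ => hXp i) hδ
  rw [hmean, hvar] at hch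
  simp only [Finset.sum_apply] at hch
  refine hch.trans (ENNReal.ofReal_le_ofReal ?_)
  gcongr with i
  exact hv1 i

lemma aux_prob {ι : Type*} [Fintype ι] (w : ι → ℝ) (δ : ℝ) (hδ : 0 < δ) :
    (Measure.pi fun _ : ι => (volume : Measure ℝ).restrict (Set.Icc 0 1))
      {x | δ ≤ |∑ i, x i * w i - (∑ i, w i) / 2|} ≤ ENNReal.ofReal ((∑ i, w i ^ 2) / δ ^ 2) := by
  have : IsProbabilityMeasure ((volume : Measure ℝ).restrict (Set.Icc 0 1)) := ⟨by simp⟩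
  refine aux_prob' w δ hδ _ (ae_restrict_mem measurableSet_Icc) ?_
  rw [integral_Icc_eq_integral_Ioc, ← intervalIntegral.integral_of_le (by norm_num)]
  simp

lemma aux_pow_up (x k : ℕ) : (x + 1) ^ (k + 1) ≤ x ^ (k + 1) + (k + 1) * (x + 1) ^ k := by
  induction k with
  | zero => simp
  | succ k ih =>
    have h : x ^ (k + 1) ≤ (x + 1) ^ (k + 1) := Nat.pow_le_pow_left (by omega) _
    calc (x + 1) ^ (k + 1 + 1) = x * (x + 1) ^ (k + 1) + (x + 1) ^ (k + 1) := by ring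
      _ ≤ x * (x ^ (k + 1) + (k + 1) * (x + 1) ^ k) + (x + 1) ^ (k + 1) := by gcongr
      _ ≤ x ^ (k + 1 + 1) + (k + 1) * ((x + 1) * (x + 1) ^ k) + (x + 1) ^ (k + 1) := by
        have : x * (x + 1) ^ k ≤ (x + 1) * (x + 1) ^ k := by gcongr; omega
        have h3 := Nat.mul_le_mul_left (k + 1) this
        calc _ = x ^ (k + 1 + 1) + (k + 1) * (x * (x + 1) ^ k) + (x + 1) ^ (k + 1) := by ring
          _ ≤ _ := by gcongr
      _ = _ := by ring

lemma aux_pow_low (x k : ℕ) : x ^ (k + 1) + (k + 1) * x ^ k ≤ (x + 1) ^ (k + 1) := by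
  induction k with
  | zero => simp
  | succ k ih =>
    calc x ^ (k + 1 + 1) + (k + 1 + 1) * x ^ (k + 1)
        ≤ (x ^ (k + 1) + (k + 1) * x ^ k) * (x + 1) := by ring_nf; nlinarith [Nat.zero_le (x ^ k)]
      _ ≤ (x + 1) ^ (k + 1) * (x + 1) := by gcongr
      _ = _ := by ring

lemma sigma_zero (a : ℕ) : sigmaFn 0 a = 1 := by simp [sigmaFn]

lemma sigma_succ_zero (b : ℕ) : sigmaFn (b + 1) 0 = 0 := by
  simp [sigmaFn]

lemma sigma_rec (b a : ℕ) :
    sigmaFn (b + 1) (a + 1) = sigmaFn (b + 1) a + (a + 1) * sigmaFn b a := by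
  unfold sigmaFn
  have hI : Finset.Icc 1 (a + 1) = insert (a + 1) (Finset.Icc 1 a) := by
    ext x; simp; omega
  have hni : a + 1 ∉ Finset.Icc 1 a := by simp
  have hni' : ∀ J ∈ (Finset.Icc 1 a).powersetCard b, a + 1 ∉ J := fun J hJ h =>
    hni ((Finset.mem_powersetCard.1 hJ).1 h)
  rw [hI, Finset.powersetCard_succ_insert hni, Finset.sum_union, Finset.sum_image, Finset.mul_sum]
  · congr 1
    exact Finset.sum_congr rfl fun J hJ => Finset.prod_insert (hni' J hJ)
  · intro J hJ K hK h
    have h' : insert (a + 1) J = insert (a + 1) K := h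
    rw [← Finset.erase_insert (hni' J hJ), h', Finset.erase_insert (hni' K hK)]
  · rw [Finset.disjoint_left]
    intro J hJ hJ'
    obtain ⟨K, _, rfl⟩ := Finset.mem_image.1 hJ'
    exact hni ((Finset.mem_powersetCard.1 hJ).1 (Finset.mem_insert_self _ _))

lemma sigma_low (u : ℕ) : ∀ s, s ^ (2 * u) ≤ 2 ^ u * u.factorial * sigmaFn u (s + u) := by
  induction u with
  | zero => simp [sigma_zero]
  | succ u ih =>
    intro s
    induction s with
    | zero => simp
    | succ s ihs =>
      have h1 := aux_pow_up s (2 * u + 1)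
      have h2 := ih (s + 1)
      rw [show s + 1 + (u + 1) = (s + (u + 1)) + 1 by ring, sigma_rec,
        show s + (u + 1) = s + 1 + u by ring]
      rw [show s + (u + 1) = s + 1 + u by ring] at ihs
      rw [Nat.factorial_succ] at *
      calc (s + 1) ^ (2 * (u + 1)) ≤ s ^ (2 * (u + 1)) + (2 * u + 1 + 1) * ((s + 1) ^ (2 * u) * (s + 1)) := by
            convert h1 using 2 <;> ring
        _ ≤ 2 ^ (u + 1) * ((u + 1) * u.factorial) * sigmaFn (u + 1) (s + 1 + u) +
            (2 * u + 1 + 1) * ((2 ^ u * u.factorial * sigmaFn u (s + 1 + u)) * (s + 1 + u + 1)) := by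
            gcongr; omega
        _ = _ := by ring

lemma sigma_up (u : ℕ) : ∀ a, 2 ^ u * u.factorial * sigmaFn u a ≤ (a + 1) ^ (2 * u) := by
  induction u with
  | zero => simp [sigma_zero]
  | succ u ih =>
    intro a
    induction a with
    | zero => simp [sigma_succ_zero]
    | succ a iha =>
      have h1 := aux_pow_low (a + 1) (2 * u + 1)
      have h2 := ih a
      rw [sigma_rec]
      rw [Nat.factorial_succ] at *
      calc 2 ^ (u + 1) * ((u + 1) * u.factorial) * (sigmaFn (u + 1) a + (a + 1) * sigmaFn u a)
          = 2 ^ (u + 1) * ((u + 1) * u.factorial) * sigmaFn (u + 1) a +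
            (2 * u + 1 + 1) * ((2 ^ u * u.factorial * sigmaFn u a) * (a + 1)) := by ring
        _ ≤ (a + 1) ^ (2 * (u + 1)) + (2 * u + 1 + 1) * ((a + 1) ^ (2 * u) * (a + 1)) := by gcongr
        _ ≤ _ := by convert h1 using 2 <;> ring

/-- the one-sided normalised ratio -/
def Gfn (u s : ℕ) : ℝ :=
  2 ^ u * u.factorial * sigmaFn u (s + u) * s.factorial / ((s + u).factorial * (s : ℝ) ^ u)

/-- the one-sided smallness ratio -/
def Hfn (u s : ℕ) : ℝ := 2 ^ u * u.factorial * ((s : ℝ) + u) ^ u / (s : ℝ) ^ (2 * u)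

lemma aux_tend (j : ℕ) : Tendsto (fun s : ℕ => ((s : ℝ) + j) / s) atTop (nhds 1) := by
  have h : Tendsto (fun s : ℕ => 1 + (j : ℝ) / s) atTop (nhds (1 + 0)) :=
    tendsto_const_nhds.add (tendsto_const_div_atTop_nhds_zero_nat _)
  rw [add_zero] at h
  refine h.congr' ?_
  filter_upwards [eventually_gt_atTop 0] with s hs
  have : (s : ℝ) ≠ 0 := by positivity
  field_simp

lemma G_tend (u : ℕ) : Tendsto (Gfn u) atTop (nhds 1) := by
  have hlow : Tendsto (fun s : ℕ => ((((s : ℝ) + u) / s) ^ u)⁻¹) atTop (nhds 1) := by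
    simpa using ((aux_tend u).pow u).inv₀ (by simp)
  have hup : Tendsto (fun s : ℕ => (((s : ℝ) + (u + 1 : ℕ)) / s) ^ (2 * u)) atTop (nhds 1) := by
    simpa using ((aux_tend (u + 1)).pow (2 * u))
  refine tendsto_of_tendsto_of_tendsto_of_le_of_le' hlow hup ?_ ?_
  · filter_upwards [eventually_gt_atTop 0] with s hs
    have hs' : (0 : ℝ) < s := by positivity
    have h1 : (s : ℝ) ^ (2 * u) ≤ 2 ^ u * u.factorial * sigmaFn u (s + u) := by
      exact_mod_cast sigma_low u s
    have h2 : ((s + u).factorial : ℝ) ≤ s.factorial * ((s : ℝ) + u) ^ u := by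
      rw [← Nat.factorial_mul_ascFactorial]
      have := Nat.ascFactorial_le_pow_add s u
      push_cast
      gcongr
      exact_mod_cast this
    unfold Gfn
    rw [div_pow, inv_div, div_le_div_iff₀ (by positivity) (by positivity)]
    calc (s : ℝ) ^ u * ((s + u).factorial * (s : ℝ) ^ u)
        = s ^ (2 * u) * (s + u).factorial := by ring
      _ ≤ (2 ^ u * u.factorial * sigmaFn u (s + u)) * (s.factorial * ((s : ℝ) + u) ^ u) := by
        gcongr
      _ = _ := by ring
  · filter_upwards [eventually_gt_atTop 0] with s hs
    have hs' : (0 : ℝ) < s := by positivity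
    have h1 : (2 ^ u * u.factorial * sigmaFn u (s + u) : ℝ) ≤ ((s : ℝ) + (u + 1 : ℕ)) ^ (2 * u) := by
      exact_mod_cast sigma_up u (s + u)
    have h2 : s.factorial * (s : ℝ) ^ u ≤ ((s + u).factorial : ℝ) := by
      have : s.factorial * s ^ u ≤ (s + u).factorial :=
        le_trans (by gcongr; omega) (Nat.factorial_mul_pow_le_factorial (m := s) (n := u))
      exact_mod_cast this
    unfold Gfn
    rw [div_pow, div_le_div_iff₀ (by positivity) (by positivity)]
    calc (2 ^ u * u.factorial * sigmaFn u (s + u) * s.factorial : ℝ) * s ^ (2 * u)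
        = (2 ^ u * u.factorial * sigmaFn u (s + u)) * (s.factorial * s ^ u) * s ^ u := by ring
      _ ≤ ((s : ℝ) + (u + 1 : ℕ)) ^ (2 * u) * (s + u).factorial * s ^ u := by gcongr
      _ = _ := by ring

lemma H_tend (u : ℕ) : Tendsto (Hfn u) atTop (nhds (if u = 0 then 1 else 0)) := by
  split_ifs with h
  · subst h
    refine tendsto_const_nhds.congr fun s => ?_
    simp [Hfn]
  · have h1 : Tendsto (fun s : ℕ => (2 ^ u * u.factorial : ℝ) * (((s : ℝ) + u) / s) ^ u * ((s : ℝ)⁻¹) ^ u)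
        atTop (nhds ((2 ^ u * u.factorial : ℝ) * 1 ^ u * 0 ^ u)) :=
      (tendsto_const_nhds.mul ((aux_tend u).pow u)).mul (tendsto_inv_atTop_nhds_zero_nat.pow u)
    rw [zero_pow h, mul_zero] at h1
    refine h1.congr' ?_
    filter_upwards [eventually_gt_atTop 0] with s hs
    have hs' : (0 : ℝ) < s := by positivity
    unfold Hfn
    rw [two_mul, pow_add, div_pow, inv_pow]
    field_simp

lemma list_prod_getD {M : Type*} [CommMonoid M] (f : ℕ → M) (l : List ℕ) :
    ∏ α ∈ Finset.range l.length, f (l.getD α 0) = (l.map f).prod := by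
  induction l with
  | nil => simp
  | cons a l ih =>
    rw [List.length_cons, Finset.prod_range_succ', List.map_cons, List.prod_cons, ← ih, mul_comm]
    simp

lemma prod_nth {M : Type*} [CommMonoid M] (f : ℕ → M) (I : Finset ℕ) :
    ∏ α ∈ Finset.range I.card, f (nthElt I α) = ∏ i ∈ I, f i := by
  have h := list_prod_getD f (I.sort (· ≤ ·))
  rw [Finset.length_sort] at h
  unfold nthElt
  rw [h, Finset.prod, ← Finset.sort_eq I (· ≤ ·), Multiset.map_coe, Multiset.prod_coe]

lemma nth_mem (I : Finset ℕ) (α : ℕ) (h : α < I.card) : nthElt I α ∈ I := by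
  unfold nthElt
  have h' : α < (I.sort (· ≤ ·)).length := by rwa [Finset.length_sort]
  rw [List.getD_eq_getElem _ _ h', ← Finset.mem_sort (· ≤ ·)]
  exact List.getElem_mem h'

lemma nth_mono (I : Finset ℕ) (α β : ℕ) (hαβ : α ≤ β) (h : β < I.card) :
    nthElt I α ≤ nthElt I β := by
  unfold nthElt
  have h' : β < (I.sort (· ≤ ·)).length := by rwa [Finset.length_sort]
  rw [List.getD_eq_getElem _ _ h', List.getD_eq_getElem _ _ (hαβ.trans_lt h')]
  exact (Finset.pairwise_sort I (· ≤ ·)).sortedLE.getElem_le_getElem_of_le hαβ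

lemma card_nth (I : Finset ℕ) (m : ℕ) :
    ((Finset.range I.card).filter (fun α => nthElt I α < m)).card
      = (I.filter (· < m)).card := by
  have h := prod_nth (M := Multiplicative ℕ)
    (fun i => Multiplicative.ofAdd (if i < m then 1 else 0)) I
  rw [Finset.card_filter, Finset.card_filter]
  exact h

lemma nth_lt_iff (I : Finset ℕ) (m u α : ℕ) (hα : α < I.card)
    (hu : (I.filter (· < m)).card = u) : nthElt I α < m ↔ α < u := by
  rw [← card_nth] at hu
  constructor
  · intro h
    have : Finset.range (α + 1) ⊆ (Finset.range I.card).filter (fun α => nthElt I α < m) := by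
      intro β hβ
      simp only [Finset.mem_range, Finset.mem_filter] at *
      exact ⟨by omega, (nth_mono I β α (by omega) hα).trans_lt h⟩
    have := Finset.card_le_card this
    rw [Finset.card_range] at this
    omega
  · intro h
    by_contra hc
    have : (Finset.range I.card).filter (fun α => nthElt I α < m) ⊆ Finset.range α := by
      intro β hβ
      simp only [Finset.mem_range, Finset.mem_filter] at *
      by_contra hcc
      exact hc ((nth_mono I α β (by omega) hβ.1).trans_lt hβ.2)
    have := Finset.card_le_card this
    rw [Finset.card_range] at this
    omega

/-- distance in the naturals -/
def ndist (m i : ℕ) : ℕ := (m - i) + (i - m)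

lemma pureNum_eq (u v p : ℕ) (I : Finset ℕ) (hI : I.card = u + v) :
    pureNum (u + v + 1) p (u + 1) I =
      if (I.filter (· < p + (u + 1))).card = u then ((∏ i ∈ I, ndist (p + (u + 1)) i : ℕ) : ℤ)
      else 0 := by
  unfold pureNum
  rw [show u + v + 1 - 1 = I.card by omega]
  split_ifs with h
  · rw [← prod_nth (ndist (p + (u + 1))) I, Nat.cast_prod]
    refine Finset.prod_congr rfl fun α hα => ?_
    have hh := nth_lt_iff I (p + (u + 1)) u α (Finset.mem_range.1 hα) h
    unfold ndist
    split_ifs with h2 <;> omega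
  · by_contra hne
    apply h
    replace hne := Finset.prod_ne_zero_iff.1 hne
    rw [← card_nth]
    have : (Finset.range I.card).filter (fun α => nthElt I α < p + (u + 1)) = Finset.range u := by
      ext α
      simp only [Finset.mem_range, Finset.mem_filter]
      constructor
      · rintro ⟨h1, h2⟩
        have := hne α (Finset.mem_range.2 h1)
        by_contra hc
        rw [if_neg (by omega)] at this
        omega
      · intro h1
        have := hne α (Finset.mem_range.2 (by omega))
        rw [if_pos (by omega)] at this
        omega
    rw [this, Finset.card_range]

lemma pureNum_nonneg (n p q : ℕ) (I : Finset ℕ) : 0 ≤ pureNum n p q I := by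
  unfold pureNum
  refine Finset.prod_nonneg fun α _ => ?_
  split_ifs <;> exact le_max_right _ _

lemma pureNum_le (u v p r : ℕ) (hr : p + u + 1 ≤ r) (I : Finset ℕ)
    (hI : I ∈ (Finset.Icc 1 r).powersetCard (u + v)) :
    pureNum (u + v + 1) p (u + 1) I ≤ ((p + u : ℕ) : ℤ) ^ u * ((r - p - (u + 1) : ℕ) : ℤ) ^ v := by
  obtain ⟨hs, hc⟩ := Finset.mem_powersetCard.1 hI
  have key : ((p + u : ℕ) : ℤ) ^ u * ((r - p - (u + 1) : ℕ) : ℤ) ^ v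
      = ∏ α ∈ Finset.range (u + v),
        if α < u then ((p + u : ℕ) : ℤ) else ((r - p - (u + 1) : ℕ) : ℤ) := by
    rw [Finset.prod_range_add]
    congr 1
    · rw [Finset.prod_congr rfl (g := fun _ => ((p + u : ℕ) : ℤ))]
      · simp
      · intro α hα; rw [if_pos (Finset.mem_range.1 hα)]
    · simp
  rw [key]
  unfold pureNum
  rw [show u + v + 1 - 1 = u + v by omega]
  refine Finset.prod_le_prod (fun α _ => by split_ifs <;> exact le_max_right _ _) fun α hα => ?_
  have hm := Finset.mem_Icc.1 (hs (nth_mem I α (hc ▸ Finset.mem_range.1 hα)))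
  split_ifs <;> omega

lemma sum_split (u v m r : ℕ) (f : ℕ → ℕ) (hm : 1 ≤ m) (hr : m ≤ r) :
    ∑ I ∈ (Finset.Icc 1 r).powersetCard (u + v),
      (if (I.filter (· < m)).card = u then ∏ i ∈ I, f i else 0)
    = (∑ J ∈ (Finset.Ico 1 m).powersetCard u, ∏ i ∈ J, f i) *
      (∑ K ∈ (Finset.Icc m r).powersetCard v, ∏ i ∈ K, f i) := by
  rw [← Finset.sum_filter, Finset.sum_mul_sum, ← Finset.sum_product']
  refine Finset.sum_nbij' (fun I => (I.filter (· < m), I.filter (¬ · < m)))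
    (fun x => x.1 ∪ x.2) ?_ ?_ ?_ ?_ ?_
  · intro I hI
    simp only [Finset.mem_filter, Finset.mem_powersetCard, Finset.mem_product] at *
    obtain ⟨⟨h1, h2⟩, h3⟩ := hI
    have h4 := Finset.card_filter_add_card_filter_not (s := I) (· < m)
    refine ⟨⟨?_, h3⟩, ?_, by omega⟩
    · intro i hi
      have := Finset.mem_filter.1 hi
      have := Finset.mem_Icc.1 (h1 this.1)
      rw [Finset.mem_Ico]; omega
    · intro i hi
      have := Finset.mem_filter.1 hi
      have := Finset.mem_Icc.1 (h1 this.1)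
      rw [Finset.mem_Icc]; omega
  · rintro ⟨J, K⟩ hx
    simp only [Finset.mem_filter, Finset.mem_powersetCard, Finset.mem_product] at *
    obtain ⟨⟨h1, h2⟩, h3, h4⟩ := hx
    have hd : Disjoint J K := by
      rw [Finset.disjoint_left]
      intro i hi hi'
      have a1 := Finset.mem_Ico.1 (h1 hi)
      have a2 := Finset.mem_Icc.1 (h3 hi')
      omega
    have hf : (J ∪ K).filter (· < m) = J := by
      ext i
      simp only [Finset.mem_filter, Finset.mem_union]
      constructor
      · rintro ⟨h | h, hi⟩
        · exact h
        · have := Finset.mem_Icc.1 (h3 h); omega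
      · intro h
        exact ⟨Or.inl h, (Finset.mem_Ico.1 (h1 h)).2⟩
    refine ⟨⟨?_, by rw [Finset.card_union_of_disjoint hd]; omega⟩, by rw [hf]; exact h2⟩
    intro i hi
    rw [Finset.mem_Icc]
    rcases Finset.mem_union.1 hi with h | h
    · have := Finset.mem_Ico.1 (h1 h); omega
    · have := Finset.mem_Icc.1 (h3 h); omega
  · intro I _
    exact Finset.filter_union_filter_not_eq (· < m) I
  · rintro ⟨J, K⟩ hx
    simp only [Finset.mem_powersetCard, Finset.mem_product] at hx
    obtain ⟨⟨h1, h2⟩, h3, h4⟩ := hx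
    ext i
    · simp only [Finset.mem_filter, Finset.mem_union]
      constructor
      · rintro ⟨h | h, hi⟩
        · exact h
        · have := Finset.mem_Icc.1 (h3 h); omega
      · intro h
        exact ⟨Or.inl h, (Finset.mem_Ico.1 (h1 h)).2⟩
    · simp only [Finset.mem_filter, Finset.mem_union]
      constructor
      · rintro ⟨h | h, hi⟩
        · have := Finset.mem_Ico.1 (h1 h); omega
        · exact h
      · intro h
        have := Finset.mem_Icc.1 (h3 h)
        exact ⟨Or.inr h, by omega⟩
  · intro I _
    exact (Finset.prod_filter_mul_prod_filter_not I (· < m) f).symm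

lemma esum_reindex (b : ℕ) (f : ℕ → ℕ) (s t : Finset ℕ) (hf : Set.InjOn f s)
    (him : s.image f = t) :
    ∑ J ∈ s.powersetCard b, ∏ i ∈ J, f i = ∑ J ∈ t.powersetCard b, ∏ j ∈ J, j := by
  have h1 := Finset.esymm_map_val f s b
  have h2 := Finset.esymm_map_val (fun i : ℕ => i) t b
  rw [← h1, ← h2, ← him, Finset.image_val_of_injOn hf, Multiset.map_id']

lemma esum_left (u m : ℕ) (hm : 1 ≤ m) :
    ∑ J ∈ (Finset.Ico 1 m).powersetCard u, ∏ i ∈ J, ndist m i = sigmaFn u (m - 1) := by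
  refine esum_reindex u (ndist m) _ _ ?_ ?_
  · intro i hi j hj h
    simp only [Finset.coe_Ico, Set.mem_Ico, ndist] at *
    omega
  · ext i
    simp only [Finset.mem_image, Finset.mem_Ico, Finset.mem_Icc, ndist]
    constructor
    · rintro ⟨j, hj, rfl⟩; omega
    · intro h; exact ⟨m - i, by omega, by omega⟩

lemma esum_right (v m r : ℕ) (hr : m ≤ r) :
    ∑ J ∈ (Finset.Icc m r).powersetCard v, ∏ i ∈ J, ndist m i = sigmaFn v (r - m) := by
  rw [esum_reindex v (ndist m) _ (Finset.range (r - m + 1))]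
  · symm
    unfold sigmaFn
    refine Finset.sum_subset (Finset.powersetCard_mono ?_) ?_
    · intro i hi
      rw [Finset.mem_Icc] at hi; rw [Finset.mem_range]; omega
    · intro J hJ hJ'
      obtain ⟨h1, h2⟩ := Finset.mem_powersetCard.1 hJ
      by_contra hne
      apply hJ'
      rw [Finset.mem_powersetCard]
      refine ⟨fun i hi => ?_, h2⟩
      have a1 := Finset.prod_ne_zero_iff.1 hne i hi
      have a2 := Finset.mem_range.1 (h1 hi)
      rw [Finset.mem_Icc]; omega
  · intro i hi j hj h
    simp only [Finset.coe_Icc, Set.mem_Icc, ndist] at *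
    omega
  · ext i
    simp only [Finset.mem_image, Finset.mem_range, Finset.mem_Icc, ndist]
    constructor
    · rintro ⟨j, hj, rfl⟩; omega
    · intro h; exact ⟨m + i, by omega, by omega⟩

lemma sum_pureNum (u v p r : ℕ) (hr : p + u + 1 ≤ r) :
    ∑ I ∈ (Finset.Icc 1 r).powersetCard (u + v), pureNum (u + v + 1) p (u + 1) I
      = ((sigmaFn u (p + u) * sigmaFn v (r - p - (u + 1)) : ℕ) : ℤ) := by
  have h := sum_split u v (p + (u + 1)) r (ndist (p + (u + 1))) (by omega) (by omega)
  rw [esum_left _ _ (by omega), esum_right _ _ _ (by omega),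
    show p + (u + 1) - 1 = p + u by omega,
    show r - (p + (u + 1)) = r - p - (u + 1) by omega] at h
  rw [← h, Nat.cast_sum]
  refine Finset.sum_congr rfl fun I hI => ?_
  rw [pureNum_eq u v p I (Finset.mem_powersetCard.1 hI).2]
  split_ifs <;> simp

lemma G_nonneg (u s : ℕ) : 0 ≤ Gfn u s := by unfold Gfn; positivity

lemma H_nonneg (u s : ℕ) : 0 ≤ Hfn u s := by unfold Hfn; positivity

lemma H_bound (u s : ℕ) (hs : 0 < s) :
    ((s + u : ℕ) : ℝ) ^ u ≤ Hfn u s * sigmaFn u (s + u) := by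
  have hs' : (0 : ℝ) < s := by positivity
  have h1 : (s : ℝ) ^ (2 * u) ≤ 2 ^ u * u.factorial * sigmaFn u (s + u) := by
    exact_mod_cast sigma_low u s
  unfold Hfn
  rw [div_mul_eq_mul_div, le_div_iff₀ (by positivity)]
  push_cast
  calc ((s : ℝ) + u) ^ u * s ^ (2 * u)
      ≤ ((s : ℝ) + u) ^ u * (2 ^ u * u.factorial * sigmaFn u (s + u)) := by gcongr
    _ = _ := by ring

/-- the normalising quotient -/
def Aq (u v s t : ℕ) : ℝ :=
  ((s + t).factorial : ℝ) / ((s + u).factorial * (t + v).factorial) /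
    (((s + t).choose s : ℝ) * muFn (u + v + 1) (u + 1) (s + t + (u + v + 1)) s)

lemma mu_eq (u v s t : ℕ) : muFn (u + v + 1) (u + 1) (s + t + (u + v + 1)) s
    = (1 / 2 ^ (u + v + 1)) * ((s : ℝ) ^ u * (t : ℝ) ^ v) / (u.factorial * v.factorial) := by
  unfold muFn
  rw [show u + 1 - 1 = u by omega, show u + v + 1 - (u + 1) = v by omega]
  congr 4
  push_cast
  ring

lemma Aq_nonneg (u v s t : ℕ) : 0 ≤ Aq u v s t := by
  unfold Aq
  rw [mu_eq]
  positivity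

lemma Aq_sum (u v s t : ℕ) (hs : 0 < s) (ht : 0 < t) :
    Aq u v s t * (sigmaFn u (s + u) * sigmaFn v (t + v)) = 2 * (Gfn u s * Gfn v t) := by
  have hs' : (0 : ℝ) < s := by positivity
  have ht' : (0 : ℝ) < t := by positivity
  unfold Aq Gfn
  rw [mu_eq, Nat.cast_add_choose]
  have h1 := Nat.cast_ne_zero (R := ℝ).2 (Nat.factorial_ne_zero s)
  have h2 := Nat.cast_ne_zero (R := ℝ).2 (Nat.factorial_ne_zero t)
  have h3 := Nat.cast_ne_zero (R := ℝ).2 (Nat.factorial_ne_zero (s + t))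
  have h4 := Nat.cast_ne_zero (R := ℝ).2 (Nat.factorial_ne_zero (s + u))
  have h5 := Nat.cast_ne_zero (R := ℝ).2 (Nat.factorial_ne_zero (t + v))
  have h6 := Nat.cast_ne_zero (R := ℝ).2 (Nat.factorial_ne_zero u)
  have h7 := Nat.cast_ne_zero (R := ℝ).2 (Nat.factorial_ne_zero v)
  field_simp
  ring

lemma kPure_eq (u v s t : ℕ) (I : Finset ℕ) :
    kPure (u + v + 1) (s + t + (u + v + 1)) s (u + 1) I /
      ((((s + t + (u + v + 1) - (u + v + 1)).choose s : ℕ) : ℝ) *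
        muFn (u + v + 1) (u + 1) (s + t + (u + v + 1)) s)
    = Aq u v s t * (pureNum (u + v + 1) s (u + 1) I : ℝ) := by
  unfold kPure Aq
  rw [show s + t + (u + v + 1) - (u + v + 1) = s + t by omega,
    show s + (u + 1) - 1 = s + u by omega,
    show s + t + (u + v + 1) - s - (u + 1) = t + v by omega]
  ring

lemma core (u v s t : ℕ) (hs : 0 < s) (ht : 0 < t) (ε : ℝ) (hε : 0 < ε)
    (hG : |Gfn u s * Gfn v t - 1| < ε / 2) :
    cubeMeasure (u + v + 1) (s + t + (u + v + 1))
      {x | |kRand (u + v + 1) (s + t + (u + v + 1)) s (u + 1) x /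
          (((s + t + (u + v + 1) - (u + v + 1)).choose s : ℝ) *
            muFn (u + v + 1) (u + 1) (s + t + (u + v + 1)) s) - 1| > ε} ≤
      ENNReal.ofReal (4 * (Gfn u s * Gfn v t) ^ 2 * (Hfn u s * Hfn v t) / (ε / 2) ^ 2) := by
  set n := u + v + 1 with hn
  set r := s + t + n with hr
  set w : ↥((Finset.Icc 1 r).powersetCard (n - 1)) → ℝ :=
    fun I => Aq u v s t * (pureNum n s (u + 1) (I : Finset ℕ) : ℝ) with hw
  have hnn : n - 1 = u + v := by omega
  have hb : r - s - (u + 1) = t + v := by omega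
  have hP0 : ∀ I, (0 : ℝ) ≤ (pureNum n s (u + 1) I : ℝ) := fun I => by
    exact_mod_cast pureNum_nonneg _ _ _ _
  have hw0 : ∀ I, 0 ≤ w I := fun I => mul_nonneg (Aq_nonneg _ _ _ _) (hP0 _)
  have hsum : ∑ I, w I = 2 * (Gfn u s * Gfn v t) := by
    rw [← Aq_sum u v s t hs ht]
    simp only [hw]
    rw [← Finset.mul_sum]
    congr 1
    rw [Finset.sum_coe_sort ((Finset.Icc 1 r).powersetCard (n - 1))
      (fun I => (pureNum n s (u + 1) I : ℝ)), hnn]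
    have := sum_pureNum u v s r (by omega)
    rw [hb] at this
    exact_mod_cast this
  have hmax : ∀ I, w I ≤ 2 * (Gfn u s * Gfn v t) * (Hfn u s * Hfn v t) := by
    intro I
    have h1 : (pureNum n s (u + 1) (I : Finset ℕ) : ℝ)
        ≤ ((s + u : ℕ) : ℝ) ^ u * ((t + v : ℕ) : ℝ) ^ v := by
      have := pureNum_le u v s r (by omega) I (by rw [← hnn]; exact I.2)
      rw [hb] at this
      exact_mod_cast this
    rw [← Aq_sum u v s t hs ht]
    calc w I ≤ Aq u v s t * ((Hfn u s * sigmaFn u (s + u)) * (Hfn v t * sigmaFn v (t + v))) := by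
          refine mul_le_mul_of_nonneg_left (h1.trans ?_) (Aq_nonneg _ _ _ _)
          exact mul_le_mul (H_bound u s hs) (H_bound v t ht) (by positivity)
            (mul_nonneg (H_nonneg _ _) (by positivity))
      _ = _ := by ring
  have hsq : ∑ I, w I ^ 2 ≤ 4 * (Gfn u s * Gfn v t) ^ 2 * (Hfn u s * Hfn v t) := by
    calc ∑ I, w I ^ 2 ≤ ∑ I, (2 * (Gfn u s * Gfn v t) * (Hfn u s * Hfn v t)) * w I := by
          refine Finset.sum_le_sum fun I _ => ?_
          rw [sq]
          exact mul_le_mul_of_nonneg_right (hmax I) (hw0 I)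
      _ = _ := by rw [← Finset.mul_sum, hsum]; ring
  have hp := aux_prob w (ε / 2) (by positivity)
  refine le_trans (measure_mono ?_) (hp.trans (ENNReal.ofReal_le_ofReal (by gcongr)))
  intro x hx
  simp only [Set.mem_setOf_eq] at hx ⊢
  have hk : kRand n r s (u + 1) x / (((r - n).choose s : ℝ) * muFn n (u + 1) r s)
      = ∑ I, x I * w I := by
    unfold kRand
    rw [Finset.sum_div]
    refine Finset.sum_congr rfl fun I _ => ?_
    rw [mul_div_assoc]
    congr 1
    exact kPure_eq u v s t I
  rw [hk] at hx
  rw [hsum, mul_div_cancel_left₀ _ (two_ne_zero)]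
  by_contra hc
  push Not at hc
  have := abs_sub_le (∑ I, x I * w I) (Gfn u s * Gfn v t) 1
  linarith

theorem stmt8 (n q : ℕ) (hn : 2 ≤ n) (hq1 : 1 ≤ q) (hqn : q ≤ n)
    (c : ℝ) (hc0 : 0 < c) (hc : c < 1 / 2) :
    ∀ ε : ℝ, 0 < ε → ∀ η : ℝ, 0 < η → ∃ R : ℕ, ∀ r : ℕ, R ≤ r → ∀ p : ℕ,
      p ≤ r - n → c * r ≤ (p : ℝ) → (p : ℝ) ≤ (1 - c) * r →
      cubeMeasure n r {x | |kRand n r p q x /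
          (((r - n).choose p : ℝ) * muFn n q r p) - 1| > ε} <
        ENNReal.ofReal η := by
  intro ε hε η hη
  obtain ⟨u, rfl⟩ : ∃ u, q = u + 1 := ⟨q - 1, by omega⟩
  obtain ⟨v, rfl⟩ : ∃ v, n = u + v + 1 := ⟨n - (u + 1), by omega⟩
  have hGG : Tendsto (fun x : ℕ × ℕ => Gfn u x.1 * Gfn v x.2) atTop (nhds 1) := by
    rw [← prod_atTop_atTop_eq]
    simpa using ((G_tend u).comp tendsto_fst).mul ((G_tend v).comp tendsto_snd)
  have hHH : Tendsto (fun x : ℕ × ℕ => Hfn u x.1 * Hfn v x.2) atTop (nhds 0) := by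
    rw [← prod_atTop_atTop_eq]
    have h := ((H_tend u).comp tendsto_fst).mul ((H_tend v).comp
      (tendsto_snd (f := (atTop : Filter ℕ)) (g := (atTop : Filter ℕ))))
    have h0 : ((if u = 0 then 1 else 0) * (if v = 0 then 1 else 0) : ℝ) = 0 := by
      split_ifs <;> first | omega | simp
    rw [h0] at h
    exact h
  have hV : Tendsto (fun x : ℕ × ℕ => 4 * (Gfn u x.1 * Gfn v x.2) ^ 2 *
      (Hfn u x.1 * Hfn v x.2) / (ε / 2) ^ 2) atTop (nhds 0) := by
    simpa using (((hGG.pow 2).const_mul 4).mul hHH).div_const ((ε / 2) ^ 2)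
  have e1 : ∀ᶠ x : ℕ × ℕ in atTop, |Gfn u x.1 * Gfn v x.2 - 1| < ε / 2 := by
    have := (Metric.tendsto_nhds.1 hGG) (ε / 2) (by positivity)
    simpa [Real.dist_eq] using this
  have e2 := hV.eventually_lt_const hη
  obtain ⟨⟨S, S'⟩, hS⟩ := eventually_atTop.1 (e1.and e2)
  obtain ⟨R, hR⟩ := exists_nat_gt (((S : ℝ) + S' + 1 + (u + v + 1)) / c)
  refine ⟨R + (u + v + 1), fun r hr p hp h1 h2 => ?_⟩
  obtain ⟨t, rfl⟩ : ∃ t, r = p + t + (u + v + 1) := ⟨r - (u + v + 1) - p, by omega⟩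
  rw [div_lt_iff₀ hc0] at hR
  have hR' : (R : ℝ) * c ≤ c * ((p + t + (u + v + 1) : ℕ) : ℝ) := by
    rw [mul_comm]
    have : (R : ℝ) ≤ ((p + t + (u + v + 1) : ℕ) : ℝ) := by exact_mod_cast (by omega)
    gcongr
  have hpS : S + S' + 1 ≤ p := by
    have : ((S + S' + 1 : ℕ) : ℝ) ≤ p := by push_cast at *; linarith
    exact_mod_cast this
  have htS : S + S' + 1 ≤ t := by
    have : ((S + S' + 1 : ℕ) : ℝ) ≤ t := by push_cast at *; linarith
    exact_mod_cast this
  obtain ⟨a1, a2⟩ := hS (p, t) ⟨by simp; omega, by simp; omega⟩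
  exact (core u v p t (by omega) (by omega) ε hε a1).trans_lt
    ((ENNReal.ofReal_lt_ofReal_iff hη).2 a2)
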